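/- arXiv:2111.10727 — 2 statements merged into one kernel-verified Lean document; each statement's English description precedes it below -/
import Mathlib

section
/- For every integer j ≥ 2, the second derivative of the normalized Legendre polynomial satisfies p_j''(x) = √(2j+1) · Σ_{k=0, k+j even}^{j−2} (k + 1/2) ( j(j+1) − k(k+1) ) p_k(x) / √(2k+1) for all x. -/
open MeasureTheory intervalIntegral

/-- Normalized Legendre polynomial on `[-1,1]`:
`p_n(x) = √(n + 1/2) · (1/(2ⁿ n!)) · (d/dx)ⁿ (x² − 1)ⁿ`, so `∫_{-1}^1 p_m p_n = δ_{mn}`. -/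
noncomputable def legP (n : ℕ) (x : ℝ) : ℝ :=
  Real.sqrt ((n : ℝ) + 1/2) * (1 / ((2:ℝ)^n * (Nat.factorial n : ℝ))) *
    iteratedDeriv n (fun y : ℝ => (y^2 - 1)^n) x

/-- `β_j = j(j+1)√(2j+1) / ((j+2)(j+3)√(2j+5))`. -/
noncomputable def betaC (j : ℕ) : ℝ :=
  ((j:ℝ) * ((j:ℝ) + 1) * Real.sqrt (2*(j:ℝ) + 1)) /
    (((j:ℝ) + 2) * ((j:ℝ) + 3) * Real.sqrt (2*(j:ℝ) + 5))

/-- `α_j = √(1 + β_j²)`. -/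
noncomputable def alphaC (j : ℕ) : ℝ := Real.sqrt (1 + (betaC j)^2)

/-- `q_j = (p_j − β_j p_{j+2}) / α_j`. -/
noncomputable def qP (j : ℕ) (x : ℝ) : ℝ := (legP j x - betaC j * legP (j+2) x) / alphaC j

open Polynomial in
/-- The classical Legendre polynomial given by the Rodrigues formula, normalized to be `1` at `1`. -/
noncomputable def legendrePoly (n : ℕ) : ℝ[X] :=
  C (1 / ((2:ℝ)^n * (n.factorial : ℝ))) * derivative^[n] ((X^2 - 1)^n)

theorem legendrePoly_zero : legendrePoly 0 = 1 := by simp [legendrePoly]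

theorem legendrePoly_one : legendrePoly 1 = Polynomial.X := by
  rw [legendrePoly]
  simp only [Function.iterate_one, pow_one, Polynomial.derivative_sub,
    Polynomial.derivative_X_sq, Polynomial.derivative_one, sub_zero, ← mul_assoc,
    ← Polynomial.C_mul]
  norm_num

theorem iteratedDeriv_polynomial_eval (n : ℕ) (p : Polynomial ℝ) :
    iteratedDeriv n (fun y => p.eval y) = fun y => (Polynomial.derivative^[n] p).eval y := by
  induction n with
  | zero => simp
  | succ n ih =>
    rw [iteratedDeriv_succ, ih]
    funext y
    rw [Polynomial.deriv, Function.iterate_succ_apply']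

theorem legP_eq_eval (n : ℕ) :
    legP n = fun x => (Polynomial.C (Real.sqrt ((n:ℝ) + 1/2)) * legendrePoly n).eval x := by
  funext x
  have h := congrFun (iteratedDeriv_polynomial_eval n ((Polynomial.X^2 - 1)^n)) x
  simp only [Polynomial.eval_pow, Polynomial.eval_sub, Polynomial.eval_X,
    Polynomial.eval_one] at h
  rw [legP, h, legendrePoly, Polynomial.eval_C_mul, Polynomial.eval_C_mul, mul_assoc]

open Polynomial in
theorem iterate_two_derivative_X_sq_sub_one_pow (n : ℕ) :
    derivative^[2] ((X^2 - 1 : ℝ[X])^(n+2)) =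
      C (2*((n:ℝ)+2)*(2*n+3)) * (X^2 - 1)^(n+1) + C (4*((n:ℝ)+2)*(n+1)) * (X^2 - 1)^n := by
  simp only [Function.iterate_succ_apply, Function.iterate_zero_apply, derivative_pow,
    derivative_sub, derivative_X, derivative_one, derivative_mul, Nat.add_sub_cancel, map_mul,
    map_add, map_natCast, map_ofNat, map_one, derivative_natCast, derivative_ofNat, derivative_zero, pow_one,
    show n + 2 - 1 = n + 1 from rfl, Nat.cast_add, Nat.cast_ofNat, Nat.cast_one,
    show 2 - 1 = 1 from rfl]
  ring

open Polynomial in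
theorem derivative_legendrePoly_add_two (n : ℕ) :
    derivative (legendrePoly (n+2)) =
      derivative (legendrePoly n) + C (2*(n:ℝ)+3) * legendrePoly (n+1) := by
  have h : derivative (derivative^[n+2] ((X^2 - 1 : ℝ[X])^(n+2))) =
      C (2*((n:ℝ)+2)*(2*n+3)) * derivative^[n+1] ((X^2 - 1)^(n+1)) +
        C (4*((n:ℝ)+2)*(n+1)) * derivative (derivative^[n] ((X^2 - 1)^n)) := by
    rw [← Function.iterate_succ_apply' derivative, ← Function.iterate_succ_apply' derivative,
      show (n+2).succ = (n+1) + 2 from rfl, Function.iterate_add_apply,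
      iterate_two_derivative_X_sq_sub_one_pow, iterate_map_add,
      iterate_derivative_C_mul, iterate_derivative_C_mul]
  have hn : (n.factorial : ℝ) ≠ 0 := by positivity
  have h1 : (n:ℝ) + 1 ≠ 0 := by positivity
  have h2 : (n:ℝ) + 2 ≠ 0 := by positivity
  simp only [legendrePoly, derivative_C_mul, h, mul_add, ← mul_assoc, ← C_mul]
  rw [add_comm]
  congr 3 <;>
  · rw [Nat.factorial_succ, pow_succ]
    try rw [Nat.factorial_succ, pow_succ]
    push_cast
    field_simp
    try ring

open Polynomial in
theorem derivative_legendrePoly (j : ℕ) :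
    derivative (legendrePoly j) =
      ∑ k ∈ Finset.range j, if Even (k + j) then 0 else C (2*(k:ℝ)+1) * legendrePoly k := by
  induction j using Nat.twoStepInduction with
  | zero => simp [legendrePoly_zero]
  | one => simp [legendrePoly_zero, legendrePoly_one]
  | more j ih _ =>
    rw [derivative_legendrePoly_add_two, Finset.sum_range_succ, Finset.sum_range_succ, ih]
    have e : ∀ k, Even (k + (j + 2)) ↔ Even (k + j) := fun k => by grind
    simp only [e]
    have h1 : ¬ Even (j + 1 + j) := by grind
    have h0 : Even (j + j) := by grind
    rw [if_pos h0, if_neg h1, add_zero]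
    push_cast
    rw [show 2 * ((j:ℝ) + 1) + 1 = 2 * j + 3 by ring]

open Polynomial in
theorem derivative_derivative_legendrePoly (j : ℕ) :
    derivative (derivative (legendrePoly j)) =
      ∑ k ∈ Finset.range j, if Even (k + j) then
        C (((k:ℝ) + 1/2) * ((j:ℝ)*((j:ℝ) + 1) - (k:ℝ)*((k:ℝ) + 1))) * legendrePoly k else 0 := by
  induction j using Nat.twoStepInduction with
  | zero => simp [legendrePoly_zero]
  | one => simp [legendrePoly_one]
  | more j ih _ =>
    rw [derivative_legendrePoly_add_two, derivative_add, derivative_C_mul, ih,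
      derivative_legendrePoly, Finset.sum_range_succ, Finset.sum_range_succ _ (j+1),
      Finset.sum_range_succ _ j]
    have e : ∀ k, Even (k + (j + 2)) ↔ Even (k + j) := fun k => by grind
    have e' : ∀ k, Even (k + (j + 1)) ↔ ¬ Even (k + j) := fun k => by grind
    have h1 : ¬ Even (j + 1 + j) := by grind
    have h0 : Even (j + j) := by grind
    simp only [e, e', h0, h1, not_true_eq_false, if_true, if_false, add_zero]
    rw [mul_add (C (2 * (j:ℝ) + 3)), Finset.mul_sum, ← add_assoc, ← Finset.sum_add_distrib]
    congr 1
    · refine Finset.sum_congr rfl fun k _ => ?_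
      by_cases hk : Even (k + j)
      · simp only [hk, not_true_eq_false, if_true, if_false, ← mul_assoc, ← C_mul, ← add_mul,
          ← C_add]
        congr 2
        push_cast
        ring
      · simp [hk]
    · rw [← mul_assoc, ← C_mul]
      congr 2
      push_cast
      ring

/-- for every `j ≥ 2` and all `x`,
`p_j''(x) = √(2j+1) Σ_{k=0, k+j even}^{j−2} (k+1/2)(j(j+1)−k(k+1)) p_k(x)/√(2k+1)`. -/
theorem legP_second_deriv_expansion (j : ℕ) (hj : 2 ≤ j) (x : ℝ) :
    iteratedDeriv 2 (legP j) x =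
      Real.sqrt (2*(j:ℝ) + 1) *
        ∑ k ∈ Finset.range (j - 1),
          if Even (k + j) then
            ((k:ℝ) + 1/2) * ((j:ℝ)*((j:ℝ) + 1) - (k:ℝ)*((k:ℝ) + 1)) * legP k x /
              Real.sqrt (2*(k:ℝ) + 1)
          else 0 := by
  obtain ⟨m, rfl⟩ : ∃ m, j = m + 1 := ⟨j - 1, by omega⟩
  have hodd : ¬ Even (m + (m + 1)) := by grind
  have hsqrt : ∀ k : ℕ, √(2*(k:ℝ) + 1) = √2 * √((k:ℝ) + 1/2) := fun k => by
    rw [← Real.sqrt_mul (by norm_num)]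
    ring_nf
  rw [legP_eq_eval, iteratedDeriv_polynomial_eval]
  beta_reduce
  rw [Function.iterate_succ_apply,
    Function.iterate_one, Polynomial.derivative_C_mul, Polynomial.derivative_C_mul,
    derivative_derivative_legendrePoly, Finset.sum_range_succ, if_neg hodd, add_zero,
    Polynomial.eval_C_mul, Polynomial.eval_finsetSum, Finset.mul_sum, Finset.mul_sum,
    Nat.add_sub_cancel]
  refine Finset.sum_congr rfl fun k _ => ?_
  split_ifs
  · have h2 : √(2:ℝ) ≠ 0 := by positivity
    have hk : √((k:ℝ) + 1/2) ≠ 0 := by positivity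
    simp only [legP_eq_eval, Polynomial.eval_C_mul, hsqrt]
    field_simp
  · simp
end

section
/- For all integers m ≥ 0 and j ≥ 1, the derivative of the radial polynomial at the endpoint satisfies (h_j^m)'(1) = μ_j^m ( m + 2(j−1)(j+m) ). -/
open MeasureTheory intervalIntegral

/-- The Jacobi polynomial `P_n^{(0,m)}` via the Rodrigues formula
`P_n^{(0,m)}(x) = ((−1)ⁿ/(2ⁿ n!)) (1+x)^{−m} (d/dx)ⁿ [ (1−x)ⁿ (1+x)^{n+m} ]`. -/
noncomputable def jacobi0 (n m : ℕ) (x : ℝ) : ℝ :=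
  ((-1:ℝ)^n / ((2:ℝ)^n * (Nat.factorial n : ℝ))) *
    iteratedDeriv n (fun y : ℝ => (1 - y)^n * (1 + y)^(n + m)) x / (1 + x)^m

/-- `μ_j^m = 2√(j + (m−1)/2)`. -/
noncomputable def muC (j m : ℕ) : ℝ := 2 * Real.sqrt ((j:ℝ) + ((m:ℝ) - 1)/2)

/-- The radial polynomial `h_j^m(r) = μ_j^m r^m P_{j−1}^{(0,m)}(2r² − 1)`. -/
noncomputable def hRad (j m : ℕ) (r : ℝ) : ℝ :=
  muC j m * r^m * jacobi0 (j - 1) m (2*r^2 - 1)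

open Polynomial in
/-- Iterated derivatives of a polynomial function are given by the formal derivatives. -/
theorem Polynomial.iteratedDeriv_eval (p : ℝ[X]) (k : ℕ) :
    iteratedDeriv k (fun y : ℝ => p.eval y) = fun y => (derivative^[k] p).eval y := by
  induction k with
  | zero => simp
  | succ k ih =>
    rw [iteratedDeriv_succ, ih]
    ext y
    rw [Polynomial.deriv, Function.iterate_succ_apply']

open Polynomial in
/-- The value of the `k`-th derivative in terms of the Taylor coefficients. -/
theorem Polynomial.eval_iterate_derivative_eq_taylor_coeff (p : ℝ[X]) (k : ℕ) (r : ℝ) :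
    (derivative^[k] p).eval r = (Nat.factorial k : ℝ) * (taylor r p).coeff k := by
  rw [taylor_coeff, ← factorial_smul_hasseDeriv]
  simp

open Polynomial in
/-- The value and the slope at `1` of the `n`-th derivative of `(1 - y)ⁿ q(y)`. -/
theorem Polynomial.hasDerivAt_iteratedDeriv_one_sub_pow_mul (n : ℕ) (q : ℝ[X]) :
    iteratedDeriv n (fun y : ℝ => (1 - y) ^ n * q.eval y) 1
        = (Nat.factorial n : ℝ) * ((-1) ^ n * q.eval 1) ∧
      HasDerivAt (iteratedDeriv n (fun y : ℝ => (1 - y) ^ n * q.eval y))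
        ((Nat.factorial (n + 1) : ℝ) * ((-1) ^ n * q.derivative.eval 1)) 1 := by
  have hf : (fun y : ℝ => (1 - y) ^ n * q.eval y) = fun y => ((1 - X) ^ n * q : ℝ[X]).eval y := by
    ext y; simp
  have ht : taylor 1 ((1 - X) ^ n * q : ℝ[X]) = C ((-1) ^ n) * (taylor 1 q * X ^ n) := by
    have h1 : taylor 1 (1 - X : ℝ[X]) = -X := by
      rw [map_sub, taylor_X, taylor_one]; simp
    rw [taylor_mul, taylor_pow, h1, neg_pow]
    simp only [map_pow, map_neg, map_one]
    ring
  rw [hf, Polynomial.iteratedDeriv_eval]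
  refine ⟨?_, ?_⟩
  · simp only [eval_iterate_derivative_eq_taylor_coeff, ht, coeff_C_mul]
    rw [coeff_mul_X_pow', if_pos le_rfl, Nat.sub_self, taylor_coeff_zero]
  · have h := (derivative^[n] ((1 - X) ^ n * q : ℝ[X])).hasDerivAt 1
    rw [← Function.iterate_succ_apply' (⇑derivative), eval_iterate_derivative_eq_taylor_coeff, ht,
      coeff_C_mul, coeff_mul_X_pow', if_pos (Nat.le_succ n), Nat.succ_sub le_rfl,
      Nat.sub_self, taylor_coeff_one] at h
    exact h

/-- `P_n^{(0,m)}(1) = 1` and `(P_n^{(0,m)})'(1) = n (n + m + 1) / 2`. -/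
theorem jacobi0_hasDerivAt_one (n m : ℕ) :
    jacobi0 n m 1 = 1 ∧ HasDerivAt (jacobi0 n m) ((n : ℝ) * (n + m + 1) / 2) 1 := by
  obtain ⟨h0, h1⟩ := Polynomial.hasDerivAt_iteratedDeriv_one_sub_pow_mul n
    ((1 + Polynomial.X) ^ (n + m))
  have hd : (Polynomial.derivative ((1 + Polynomial.X : Polynomial ℝ) ^ (n + m))).eval 1
      = ((n : ℝ) + m) * 2 ^ (n + m) / 2 := by
    rcases Nat.eq_zero_or_pos (n + m) with h | h
    · have hn : (n : ℝ) + m = 0 := by exact_mod_cast h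
      simp [h, hn]
    · obtain ⟨k, hk⟩ := Nat.exists_eq_succ_of_ne_zero h.ne'
      have hn : (n : ℝ) + m = k + 1 := by exact_mod_cast hk
      rw [hk, hn, Polynomial.derivative_pow]
      simp [pow_succ]
      ring
  rw [hd] at h1
  simp only [Polynomial.eval_pow, Polynomial.eval_add, Polynomial.eval_one,
    Polynomial.eval_X] at h0 h1
  have hsq : ((-1 : ℝ) ^ n) * (-1) ^ n = 1 := by rw [← mul_pow]; simp
  have hfac : (Nat.factorial n : ℝ) ≠ 0 := by exact_mod_cast Nat.factorial_ne_zero n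
  refine ⟨?_, ?_⟩
  · unfold jacobi0
    rw [h0]
    norm_num only
    rw [pow_add]
    field_simp
    linear_combination hsq
  · have hp : HasDerivAt (fun x : ℝ => (1 + x) ^ m) ((m : ℝ) * 2 ^ m / 2) 1 := by
      have h : HasDerivAt (fun x : ℝ => (1 + x) ^ m) _ 1 :=
        ((hasDerivAt_id (1 : ℝ)).const_add 1).pow m
      refine h.congr_deriv ?_
      rcases m with _ | k
      · simp
      · rw [Nat.add_sub_cancel, id, pow_succ]
        norm_num only
        ring
    have h := (h1.const_mul ((-1:ℝ)^n / ((2:ℝ)^n * (Nat.factorial n : ℝ)))).div hp (by norm_num)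
    refine h.congr_deriv ?_
    rw [h0, Nat.factorial_succ]
    push_cast
    norm_num only
    rw [pow_add]
    field_simp
    linear_combination ((n : ℝ) * (n + m + 1)) * hsq

/-- for `m ≥ 0` and `j ≥ 1`, `(h_j^m)'(1) = μ_j^m (m + 2(j−1)(j+m))`. -/
theorem hRad_deriv_at_one (m j : ℕ) (hj : 1 ≤ j) :
    deriv (hRad j m) 1 = muC j m * ((m:ℝ) + 2*((j:ℝ) - 1)*((j:ℝ) + (m:ℝ))) := by
  obtain ⟨h0, h1⟩ := jacobi0_hasDerivAt_one (j - 1) m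
  have hin : HasDerivAt (fun r : ℝ => 2 * r ^ 2 - 1) 4 1 := by
    refine (((hasDerivAt_pow 2 (1 : ℝ)).const_mul 2).sub_const 1).congr_deriv ?_
    norm_num
  have hone : (2 : ℝ) * 1 ^ 2 - 1 = 1 := by norm_num
  have hcomp := HasDerivAt.comp (1 : ℝ) (h₂ := jacobi0 (j - 1) m) (by rw [hone]; exact h1) hin
  have h := ((hasDerivAt_pow m (1 : ℝ)).const_mul (muC j m)).mul hcomp
  refine HasDerivAt.deriv (h.congr_deriv ?_)
  simp only [Function.comp_apply, one_pow, mul_one]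
  rw [show (2 : ℝ) - 1 = 1 by norm_num, h0]
  rw [Nat.cast_sub hj]
  push_cast
  ring
end
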